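/- arXiv:2507.08503 — 3 statements merged into one kernel-verified Lean document; each statement's English description precedes it below -/
import Mathlib

section
/- For every integer n ≥ 6, the Staller-start game isolation number of the path satisfies the lower bound min{2·⌈(n−2)/5⌉, 2·⌈(n−3)/5⌉ + 1} ≤ ι_g'(P_n). -/
open SimpleGraph

variable {V : Type*}

/-- The closed neighborhood `N_G[X]` of a set `X` of vertices: all vertices that are in `X`
or adjacent to a vertex of `X`. -/
def closedNbhdSet (G : SimpleGraph V) (X : Set V) : Set V :=
  {u | u ∈ X ∨ ∃ x ∈ X, G.Adj x u}

/-- A vertex `v` is playable with respect to the set `X` of already selected vertices if the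
closed neighborhood of `v` contains a vertex `u ∉ N_G[X]` having a neighbor `w ∉ N_G[X]`,
i.e. `v` dominates a vertex of a nontrivial component of `G - N_G[X]`. -/
def IsPlayable (G : SimpleGraph V) (X : Set V) (v : V) : Prop :=
  ∃ u, (u = v ∨ G.Adj v u) ∧ u ∉ closedNbhdSet G X ∧
    ∃ w, G.Adj u w ∧ w ∉ closedNbhdSet G X

open Classical in
/-- The optimal-play value (number of further selected vertices) of the isolation game
position with given fuel, player to move (`true` = Dominator, the minimizer;
`false` = Staller, the maximizer) and set `X` of already selected vertices. -/
noncomputable def isoGameVal (G : SimpleGraph V) : ℕ → Bool → Set V → ℕ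
  | 0, _, _ => 0
  | (k + 1), isDom, X =>
    if ∃ v, IsPlayable G X v then
      (if isDom then sInf else sSup)
        {n : ℕ | ∃ v, IsPlayable G X v ∧ n = isoGameVal G k (!isDom) (insert v X) + 1}
    else 0

/-- The game isolation number `ι_g(G)`: the number of vertices selected in the isolation
game on `G` when Dominator moves first and both players play optimally.  (A game on a
graph with `n` vertices lasts at most `n` moves, so fuel `Fintype.card V` suffices.) -/
noncomputable def iotaGame (G : SimpleGraph V) [Fintype V] : ℕ :=
  isoGameVal G (Fintype.card V) true ∅

/-- The Staller-start game isolation number `ι_g'(G)`: the number of vertices selected in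
the isolation game on `G` when Staller moves first and both players play optimally. -/
noncomputable def iotaGame' (G : SimpleGraph V) [Fintype V] : ℕ :=
  isoGameVal G (Fintype.card V) false ∅

/-! ### Bounds on the value of the isolation game -/

theorem isoGameVal_le (G : SimpleGraph V) (k : ℕ) (b : Bool) (X : Set V) :
    isoGameVal G k b X ≤ k := by
  induction k generalizing b X with
  | zero => simp [isoGameVal]
  | succ k ih =>
    rw [isoGameVal]
    split_ifs with h hb
    · obtain ⟨v, hv⟩ := h
      exact le_trans (Nat.sInf_le ⟨v, hv, rfl⟩) (Nat.succ_le_succ (ih _ _))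
    · obtain ⟨v, hv⟩ := h
      refine csSup_le ⟨_, v, hv, rfl⟩ ?_
      rintro m ⟨w, -, rfl⟩
      exact Nat.succ_le_succ (ih _ _)
    · exact Nat.zero_le _

theorem isoGameVal_succ_le_isoGameVal_staller {G : SimpleGraph V} {X : Set V} {v : V}
    (hv : IsPlayable G X v) (k : ℕ) :
    isoGameVal G k true (insert v X) + 1 ≤ isoGameVal G (k + 1) false X := by
  rw [isoGameVal, if_pos (Exists.intro v hv)]
  refine le_csSup ⟨k + 1, ?_⟩ ⟨v, hv, rfl⟩
  rintro m ⟨w, -, rfl⟩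
  exact Nat.succ_le_succ (isoGameVal_le _ _ _ _)

theorem exists_isoGameVal_succ_eq_isoGameVal_dominator {G : SimpleGraph V} {X : Set V}
    (h : ∃ v, IsPlayable G X v) (k : ℕ) :
    ∃ v, isoGameVal G (k + 1) true X = isoGameVal G k false (insert v X) + 1 := by
  rw [isoGameVal, if_pos h]
  obtain ⟨v, hv⟩ := h
  obtain ⟨w, -, hw⟩ := Nat.sInf_mem (s := {n : ℕ | ∃ v, IsPlayable G X v ∧
    n = isoGameVal G k (!true) (insert v X) + 1}) ⟨_, v, hv, rfl⟩
  exact ⟨w, hw⟩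

/-! ### Undominated edges of a path -/

/-- The vertex `i` of the path on `n` vertices is not dominated by `X`. -/
def IsUndominated {n : ℕ} (X : Set (Fin n)) (i : ℕ) : Prop :=
  i < n ∧ ∀ x ∈ X, ¬(x.val ≤ i + 1 ∧ i ≤ x.val + 1)

theorem isUndominated_val_iff {n : ℕ} {X : Set (Fin n)} (u : Fin n) :
    IsUndominated X u.val ↔ u ∉ closedNbhdSet (pathGraph n) X := by
  simp only [IsUndominated, closedNbhdSet, Set.mem_ofPred_eq, pathGraph_adj, u.isLt, true_and]
  constructor
  · rintro h (hu | ⟨x, hx, hxu⟩)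
    · exact h u hu (by omega)
    · exact h x hx (by omega)
  · intro h x hx hxu
    rcases eq_or_ne x u with rfl | hne
    · exact h (Or.inl hx)
    · have := Fin.val_ne_of_ne hne
      exact h (Or.inr ⟨x, hx, by omega⟩)

theorem isUndominated_insert {n : ℕ} {X : Set (Fin n)} {v : Fin n} {i : ℕ} :
    IsUndominated (insert v X) i ↔
      IsUndominated X i ∧ ¬(v.val ≤ i + 1 ∧ i ≤ v.val + 1) := by
  simp only [IsUndominated, Set.forall_mem_insert]
  tauto

theorem isPlayable_pathGraph {n : ℕ} {X : Set (Fin n)} {v : Fin n} {i j : ℕ}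
    (hvi : v.val ≤ i + 1 ∧ i ≤ v.val + 1) (hij : i + 1 = j ∨ j + 1 = i)
    (hi : IsUndominated X i) (hj : IsUndominated X j) :
    IsPlayable (pathGraph n) X v := by
  refine ⟨⟨i, hi.1⟩, ?_, (isUndominated_val_iff _).1 hi, ⟨j, hj.1⟩, ?_,
    (isUndominated_val_iff _).1 hj⟩
  · simp only [pathGraph_adj, Fin.ext_iff]
    omega
  · simpa only [pathGraph_adj] using hij

open Classical in
/-- The edges `{i, i + 1}` of the path on `n` vertices, given by their smaller endpoints,
neither of whose endpoints is dominated by `X`. -/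
noncomputable def undominatedEdges {n : ℕ} (X : Set (Fin n)) : Finset ℕ :=
  {i ∈ Finset.range n | IsUndominated X i ∧ IsUndominated X (i + 1)}

theorem mem_undominatedEdges {n : ℕ} {X : Set (Fin n)} {i : ℕ} :
    i ∈ undominatedEdges X ↔ IsUndominated X i ∧ IsUndominated X (i + 1) := by
  simp only [undominatedEdges, Finset.mem_filter, Finset.mem_range, and_iff_right_iff_imp]
  exact fun h => h.1.1

theorem card_undominatedEdges_le_insert {n : ℕ} (X : Set (Fin n)) (v : Fin n) :
    (undominatedEdges X).card ≤ (undominatedEdges (insert v X)).card + 4 := by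
  have hsub : undominatedEdges X ⊆
      undominatedEdges (insert v X) ∪ Finset.Ico (v.val - 2) (v.val + 2) := by
    intro i hi
    simp only [Finset.mem_union, Finset.mem_Ico, mem_undominatedEdges, isUndominated_insert]
      at hi ⊢
    by_cases h : v.val - 2 ≤ i ∧ i < v.val + 2
    · exact Or.inr h
    · exact Or.inl ⟨⟨hi.1, by omega⟩, hi.2, by omega⟩
  have := (Finset.card_le_card hsub).trans (Finset.card_union_le _ _)
  rw [Nat.card_Ico] at this
  omega

/-- A dominated vertex next to an undominated edge destroys no other undominated edge. -/
theorem exists_isPlayable_card_undominatedEdges_le {n : ℕ} {X : Set (Fin n)}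
    (hX : X.Nonempty) (hE : (undominatedEdges X).Nonempty) :
    ∃ v, IsPlayable (pathGraph n) X v ∧
      (undominatedEdges X).card ≤ (undominatedEdges (insert v X)).card + 1 := by
  classical
  obtain ⟨x, hx⟩ := hX
  obtain ⟨i, hi⟩ := hE
  rw [mem_undominatedEdges] at hi
  have hxdom : ¬IsUndominated X x.val := fun h => h.2 x hx (by omega)
  have card_le : ∀ (v : Fin n) (e : ℕ), (∀ m, IsUndominated X m → IsUndominated X (m + 1) →
      m ≠ e → ¬(v.val ≤ m + 1 ∧ m ≤ v.val + 1) ∧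
        ¬(v.val ≤ m + 1 + 1 ∧ m + 1 ≤ v.val + 1)) →
      (undominatedEdges X).card ≤ (undominatedEdges (insert v X)).card + 1 := by
    intro v e h
    refine (Finset.card_le_card (t := insert e (undominatedEdges (insert v X))) ?_).trans
      (Finset.card_insert_le _ _)
    intro m hm
    rw [mem_undominatedEdges] at hm
    simp only [Finset.mem_insert, mem_undominatedEdges, isUndominated_insert]
    by_cases hme : m = e
    · exact Or.inl hme
    · exact Or.inr ⟨⟨hm.1, (h m hm.1 hm.2 hme).1⟩, hm.2, (h m hm.1 hm.2 hme).2⟩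
  rcases lt_or_ge x.val i with hlt | hge
  · -- the last dominated vertex before the edge
    have hle := Nat.findGreatest_le (P := fun m => ¬IsUndominated X m) i
    have hdom := Nat.findGreatest_spec (P := fun m => ¬IsUndominated X m) hlt.le hxdom
    have hmax := fun m => Nat.findGreatest_is_greatest (P := fun m => ¬IsUndominated X m)
      (n := i) (k := m)
    generalize Nat.findGreatest (fun m => ¬IsUndominated X m) i = j at hle hdom hmax
    have hji : j ≠ i := by rintro rfl; exact hdom hi.1
    have hund : ∀ m, j < m → m ≤ i + 1 → IsUndominated X m := by
      intro m h1 h2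
      rcases Nat.lt_or_ge i m with h3 | h3
      · obtain rfl : m = i + 1 := by omega
        exact hi.2
      · exact not_not.1 (hmax m h1 h3)
    have h1 := hund (j + 1) (by omega) (by omega)
    have h2 := hund (j + 2) (by omega) (by omega)
    have hjn : j < n := by have := h1.1; omega
    have hpred : ∀ m, m + 1 = j → ¬IsUndominated X m := by
      intro m hm hmX
      refine hdom ⟨hjn, fun y hy hyj => ?_⟩
      have := h1.2 y hy
      have := hmX.2 y hy
      omega
    refine ⟨⟨j, hjn⟩, isPlayable_pathGraph (by simp only; omega) (Or.inl rfl) h1 h2,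
      card_le _ (j + 1) fun m hm hm' hne => ?_⟩
    have := hpred m
    have := hpred (m + 1)
    have : m ≠ j := by rintro rfl; exact hdom hm
    have : m + 1 ≠ j := by rintro rfl; exact hdom hm'
    have : m + 1 + 1 ≠ j := fun h => hpred (m + 1) h hm'
    simp only
    omega
  · -- the first dominated vertex after the edge
    have hex : ∃ m, i < m ∧ m < n ∧ ¬IsUndominated X m := by
      refine ⟨x.val, lt_of_le_of_ne hge ?_, x.isLt, hxdom⟩
      rintro rfl
      exact hxdom hi.1
    obtain ⟨hij, hjn, hdom⟩ := Nat.find_spec hex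
    have hmin := fun m => Nat.find_min hex (m := m)
    generalize Nat.find hex = j at hij hjn hdom hmin
    have hji : j ≠ i + 1 := by rintro rfl; exact hdom hi.2
    have hund : ∀ m, i ≤ m → m < j → IsUndominated X m := by
      intro m h1 h2
      rcases Nat.eq_or_lt_of_le h1 with rfl | h3
      · exact hi.1
      · by_contra h
        exact hmin m h2 ⟨h3, by omega, h⟩
    obtain ⟨e, rfl⟩ : ∃ e, j = e + 2 := ⟨j - 2, by omega⟩
    have h1 := hund (e + 1) (by omega) (by omega)
    have h2 := hund e (by omega) (by omega)
    have hsucc : ¬IsUndominated X (e + 3) := by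
      intro hmX
      refine hdom ⟨hjn, fun y hy hyj => ?_⟩
      have := h1.2 y hy
      have := hmX.2 y hy
      omega
    refine ⟨⟨e + 2, hjn⟩, isPlayable_pathGraph (by simp only; omega) (Or.inr rfl) h1 h2,
      card_le _ e fun m hm hm' hne => ?_⟩
    have : m ≠ e + 2 := by rintro rfl; exact hdom hm
    have : m ≠ e + 1 := by rintro rfl; exact hdom hm'
    have : m ≠ e + 3 := by rintro rfl; exact hsucc hm
    simp only
    omega

theorem exists_isPlayable_of_undominatedEdges_nonempty {n : ℕ} {X : Set (Fin n)}
    (hE : (undominatedEdges X).Nonempty) : ∃ v, IsPlayable (pathGraph n) X v := by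
  obtain ⟨i, hi⟩ := hE
  rw [mem_undominatedEdges] at hi
  exact ⟨⟨i, hi.1.1⟩, isPlayable_pathGraph (by simp only; omega) (Or.inl rfl) hi.1 hi.2⟩

/-- Once a vertex is selected, Staller can always destroy a single undominated edge, while
Dominator destroys at most four, so each round costs Dominator at most five edges. -/
theorem min_le_isoGameVal_pathGraph {n : ℕ} (k : ℕ) (X : Set (Fin n)) (hX : X.Nonempty) :
    min k ((undominatedEdges X).card / 5 + ((undominatedEdges X).card + 4) / 5) ≤
        isoGameVal (pathGraph n) k true X ∧
      min k (((undominatedEdges X).card + 4) / 5 + ((undominatedEdges X).card + 3) / 5) ≤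
        isoGameVal (pathGraph n) k false X := by
  induction k generalizing X with
  | zero => simp
  | succ k ih =>
    rcases (undominatedEdges X).eq_empty_or_nonempty with h0 | hne
    · simp [h0]
    · have hpos := hne.card_pos
      constructor
      · obtain ⟨v, hv⟩ := exists_isoGameVal_succ_eq_isoGameVal_dominator
          (exists_isPlayable_of_undominatedEdges_nonempty hne) k
        have := (ih (insert v X) (Set.insert_nonempty _ _)).2
        have := card_undominatedEdges_le_insert X v
        omega
      · obtain ⟨v, hv, hcard⟩ := exists_isPlayable_card_undominatedEdges_le hX hne
        have := (ih (insert v X) (Set.insert_nonempty _ _)).1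
        have := isoGameVal_succ_le_isoGameVal_staller hv k
        omega

/-- Inequality (3): for `n ≥ 6`,
`min {2⌈(n-2)/5⌉, 2⌈(n-3)/5⌉ + 1} ≤ ι_g'(P_n)`.
(In ℕ, `⌈m/5⌉ = (m + 4) / 5`.) -/
theorem path_stallerStart_game_isolation_lower_bound (n : ℕ) (hn : 6 ≤ n) :
    min (2 * ((n - 2 + 4) / 5)) (2 * ((n - 3 + 4) / 5) + 1) ≤
      iotaGame' (SimpleGraph.pathGraph n) := by
  obtain ⟨k, rfl⟩ : ∃ k, n = k + 1 := ⟨n - 1, by omega⟩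
  have hund : ∀ i < k + 1, IsUndominated (∅ : Set (Fin (k + 1))) i := fun i hi => ⟨hi, by simp⟩
  have hplay : IsPlayable (pathGraph (k + 1)) ∅ 0 :=
    isPlayable_pathGraph (i := 0) (by simp) (Or.inl rfl) (hund 0 (by omega))
      (hund 1 (by omega))
  have hcard : k - 2 ≤ (undominatedEdges (insert (0 : Fin (k + 1)) ∅)).card := by
    rw [← Nat.card_Ico 2 k]
    refine Finset.card_le_card fun i hi => ?_
    rw [Finset.mem_Ico] at hi
    rw [mem_undominatedEdges, isUndominated_insert, isUndominated_insert, Fin.val_zero]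
    exact ⟨⟨hund _ (by omega), by omega⟩, hund _ (by omega), by omega⟩
  have hdom := (min_le_isoGameVal_pathGraph k _ (Set.insert_nonempty (0 : Fin (k + 1)) ∅)).1
  have hstaller := isoGameVal_succ_le_isoGameVal_staller hplay k
  rw [iotaGame', Fintype.card_fin]
  omega
end

section
/- If G is a connected finite simple graph of order n, then 2·ι_g(G) ≤ n (that is, the game isolation number is at most half the order). -/
open SimpleGraph

variable {V : Type*}

/-- The undominated vertices having an undominated neighbor: the vertices of the nontrivial
components of `G - N_G[X]`. -/
def liveSet (G : SimpleGraph V) (X : Set V) : Set V :=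
  {u | u ∉ closedNbhdSet G X ∧ ∃ w, G.Adj u w ∧ w ∉ closedNbhdSet G X}

theorem mem_closedNbhdSet_insert {G : SimpleGraph V} {X : Set V} {v u : V} :
    u ∈ closedNbhdSet G (insert v X) ↔ (u = v ∨ G.Adj v u) ∨ u ∈ closedNbhdSet G X := by
  simp only [closedNbhdSet, Set.mem_insert_iff, Set.mem_ofPred_eq, exists_eq_or_imp]
  tauto

theorem liveSet_insert_subset (G : SimpleGraph V) (X : Set V) (v : V) :
    liveSet G (insert v X) ⊆ liveSet G X := by
  rintro u ⟨hu, w, huw, hw⟩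
  rw [mem_closedNbhdSet_insert, not_or] at hu hw
  exact ⟨hu.2, w, huw, hw.2⟩

theorem ncard_liveSet_insert_add_card_le [Finite V] {G : SimpleGraph V} {X : Set V} {v : V}
    (S : Finset V) (hS : ∀ u ∈ S, u ∈ liveSet G X ∧ u ∉ liveSet G (insert v X)) :
    (liveSet G (insert v X)).ncard + S.card ≤ (liveSet G X).ncard := by
  rw [← Set.ncard_coe_finset, ← Set.ncard_union_eq
    (Set.disjoint_right.2 fun u hu => (hS u hu).2) (Set.toFinite _) (Set.toFinite _)]
  exact Set.ncard_le_ncard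
    (Set.union_subset (liveSet_insert_subset G X v) fun u hu => (hS u hu).1) (Set.toFinite _)

theorem IsPlayable.ncard_liveSet_insert_lt [Finite V] {G : SimpleGraph V} {X : Set V} {v : V}
    (h : IsPlayable G X v) : (liveSet G (insert v X)).ncard + 1 ≤ (liveSet G X).ncard := by
  obtain ⟨u, huv, hu⟩ := h
  refine ncard_liveSet_insert_add_card_le {u} fun x hx => ?_
  rw [Finset.mem_singleton] at hx
  subst hx
  exact ⟨hu, fun h => h.1 (mem_closedNbhdSet_insert.2 (Or.inl huv))⟩

theorem isoGameVal_le_of_forall {G : SimpleGraph V} {k c : ℕ} {b : Bool} {X : Set V}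
    (h : ∀ v, IsPlayable G X v → isoGameVal G k (!b) (insert v X) + 1 ≤ c) :
    isoGameVal G (k + 1) b X ≤ c := by
  rw [isoGameVal]
  split_ifs with hp hb
  · obtain ⟨v, hv⟩ := hp
    exact le_trans (Nat.sInf_le ⟨v, hv, rfl⟩) (h v hv)
  · refine csSup_le' ?_
    rintro n ⟨v, hv, rfl⟩
    exact h v hv
  · exact Nat.zero_le c

theorem isoGameVal_true_le {G : SimpleGraph V} {k : ℕ} {X : Set V} {v : V}
    (hv : IsPlayable G X v) :
    isoGameVal G (k + 1) true X ≤ isoGameVal G k false (insert v X) + 1 := by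
  rw [isoGameVal, if_pos ⟨v, hv⟩]
  exact Nat.sInf_le ⟨v, hv, rfl⟩

/-- If the undominated vertices induce a graph of maximum degree at most one, then every move
removes two live vertices. -/
theorem two_mul_isoGameVal_le_of_matching [Finite V] (G : SimpleGraph V) (k : ℕ) (b : Bool)
    (X : Set V)
    (hX : ∀ u w w', u ∉ closedNbhdSet G X → w ∉ closedNbhdSet G X → w' ∉ closedNbhdSet G X →
      G.Adj u w → G.Adj u w' → w = w') :
    2 * isoGameVal G k b X ≤ (liveSet G X).ncard := by
  classical
  induction k generalizing b X with
  | zero => simp [isoGameVal]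
  | succ k ih =>
    suffices isoGameVal G (k + 1) b X ≤ (liveSet G X).ncard / 2 by lia
    refine isoGameVal_le_of_forall fun v hv => ?_
    have hrec := ih (!b) (insert v X) fun u w w' hu hw hw' => by
      rw [mem_closedNbhdSet_insert, not_or] at hu hw hw'
      exact hX u w w' hu.2 hw.2 hw'.2
    obtain ⟨u, huv, hu, w, huw, hw⟩ := hv
    have hdom : u ∈ closedNbhdSet G (insert v X) := mem_closedNbhdSet_insert.2 (Or.inl huv)
    have hdrop := ncard_liveSet_insert_add_card_le (G := G) (X := X) (v := v) {u, w} <| by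
      intro x hx
      rw [Finset.mem_insert, Finset.mem_singleton] at hx
      rcases hx with rfl | rfl
      · exact ⟨⟨hu, w, huw, hw⟩, fun h => h.1 hdom⟩
      · refine ⟨⟨hw, u, huw.symm, hu⟩, ?_⟩
        rintro ⟨-, y, hxy, hy⟩
        have hy' := hy
        rw [mem_closedNbhdSet_insert, not_or] at hy'
        exact hy (hX x u y hw hu hy'.2 huw.symm hxy ▸ hdom)
    rw [Finset.card_pair huw.ne] at hdrop
    lia

theorem two_mul_isoGameVal_le [Finite V] (G : SimpleGraph V) (k : ℕ) (X : Set V) :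
    2 * isoGameVal G k true X ≤ (liveSet G X).ncard ∧
      2 * isoGameVal G k false X ≤ (liveSet G X).ncard + 1 := by
  classical
  induction k generalizing X with
  | zero => simp [isoGameVal]
  | succ k ih =>
    constructor
    · by_cases hX : ∀ u w w', u ∉ closedNbhdSet G X → w ∉ closedNbhdSet G X →
        w' ∉ closedNbhdSet G X → G.Adj u w → G.Adj u w' → w = w'
      · exact two_mul_isoGameVal_le_of_matching G (k + 1) true X hX
      push Not at hX
      obtain ⟨u, w, w', hu, hw, hw', huw, huw', hne⟩ := hX
      have hval := isoGameVal_true_le (k := k) (v := u) ⟨u, Or.inl rfl, hu, w, huw, hw⟩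
      have hdrop := ncard_liveSet_insert_add_card_le (G := G) (X := X) (v := u) {u, w, w'} <| by
        intro x hx
        simp only [Finset.mem_insert, Finset.mem_singleton] at hx
        rcases hx with rfl | rfl | rfl
        · exact ⟨⟨hu, w, huw, hw⟩, fun h => h.1 (mem_closedNbhdSet_insert.2 (.inl (.inl rfl)))⟩
        · exact ⟨⟨hw, u, huw.symm, hu⟩,
            fun h => h.1 (mem_closedNbhdSet_insert.2 (.inl (.inr huw)))⟩
        · exact ⟨⟨hw', u, huw'.symm, hu⟩,
            fun h => h.1 (mem_closedNbhdSet_insert.2 (.inl (.inr huw')))⟩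
      rw [Finset.card_eq_three.2 ⟨u, w, w', huw.ne, huw'.ne, hne, rfl⟩] at hdrop
      have := (ih (insert u X)).2
      lia
    · suffices isoGameVal G (k + 1) false X ≤ ((liveSet G X).ncard + 1) / 2 by lia
      refine isoGameVal_le_of_forall fun v hv => ?_
      have hrec := (ih (insert v X)).1
      have hdrop := hv.ncard_liveSet_insert_lt
      rw [Bool.not_false]
      lia

/-- If `G` is a connected finite graph of order `n`, then `ι_g(G) ≤ n/2`. -/
theorem game_isolation_half_bound {V : Type*} [Fintype V] (G : SimpleGraph V)
    (hG : G.Connected) :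
    2 * iotaGame G ≤ Fintype.card V := by
  rw [← Nat.card_eq_fintype_card]
  exact (two_mul_isoGameVal_le G _ ∅).1.trans (Set.ncard_le_card _)
end

section
/- If G is a connected finite simple graph of order n satisfying 2·ι_g'(G) = n, then n ≤ 10. -/
open SimpleGraph

variable {V : Type*}

namespace IsolationGame

open Classical in
/-- The vertices of `A` that a move at `w` removes when `A` is the set of vertices in nontrivial
components: those dominated by `w`, and those all of whose neighbors in `A` are dominated. -/
noncomputable def removed (G : SimpleGraph V) (A : Finset V) (w : V) : Finset V :=
  A.filter fun x => (x = w ∨ G.Adj w x) ∨ ∀ y ∈ A, G.Adj x y → y = w ∨ G.Adj w y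

/-- Every vertex of `A` has a neighbor in `A`. -/
def NoIsolated (G : SimpleGraph V) (A : Finset V) : Prop :=
  ∀ x ∈ A, ∃ y ∈ A, G.Adj x y

open Classical in
/-- The vertices in nontrivial components of `G - N_G[X]`. -/
noncomputable def active [Fintype V] (G : SimpleGraph V) (X : Set V) : Finset V :=
  Finset.univ.filter fun x => x ∉ closedNbhdSet G X ∧ ∃ w, G.Adj x w ∧ w ∉ closedNbhdSet G X

/-- With Dominator to move and active set `A`, Dominator can keep twice the number of remaining
moves at most `A.card - e`. -/
def DomBound [Fintype V] (G : SimpleGraph V) (A : Finset V) (e : ℤ) : Prop :=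
  ∀ k X, active G X = A → 2 * (isoGameVal G k true X : ℤ) + e ≤ A.card

/-- With Staller to move and active set `A`, Dominator can keep twice the number of remaining
moves at most `A.card - e`. -/
def StallBound [Fintype V] (G : SimpleGraph V) (A : Finset V) (e : ℤ) : Prop :=
  ∀ k X, active G X = A → 2 * (isoGameVal G k false X : ℤ) + e ≤ A.card

variable {G : SimpleGraph V} {A : Finset V} {w x : V}

theorem mem_removed : x ∈ removed G A w ↔
    x ∈ A ∧ ((x = w ∨ G.Adj w x) ∨ ∀ y ∈ A, G.Adj x y → y = w ∨ G.Adj w y) := by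
  simp [removed]

theorem removed_subset : removed G A w ⊆ A := by
  intro x hx
  exact (mem_removed.1 hx).1

theorem removed_nonempty_of_dominates (hx : x ∈ A) (h : x = w ∨ G.Adj w x) :
    (removed G A w).Nonempty :=
  ⟨x, mem_removed.2 ⟨hx, Or.inl h⟩⟩

theorem exists_dominated (hA : NoIsolated G A) (h : (removed G A w).Nonempty) :
    ∃ x ∈ A, x = w ∨ G.Adj w x := by
  obtain ⟨x, hx⟩ := h
  rw [mem_removed] at hx
  obtain ⟨hxA, h | h⟩ := hx
  · exact ⟨x, hxA, h⟩
  · obtain ⟨y, hy, hxy⟩ := hA x hxA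
    exact ⟨y, hy, h y hy hxy⟩

theorem mem_removed_of_adj {y : V} (hy : y ∈ A) (h : G.Adj w y) : y ∈ removed G A w :=
  mem_removed.2 ⟨hy, Or.inl (Or.inr h)⟩

theorem mem_removed_self (hw : w ∈ A) : w ∈ removed G A w :=
  mem_removed.2 ⟨hw, Or.inl (Or.inl rfl)⟩

/-- `T` is a union of components of the subgraph induced by `A`. -/
def ClosedIn (G : SimpleGraph V) (A T : Finset V) : Prop :=
  T ⊆ A ∧ ∀ x ∈ T, ∀ y ∈ A, G.Adj x y → y ∈ T

theorem ClosedIn.noIsolated {T : Finset V} (hT : ClosedIn G A T) (hA : NoIsolated G A) :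
    NoIsolated G T := by
  intro x hx
  obtain ⟨y, hy, hxy⟩ := hA x (hT.1 hx)
  exact ⟨y, hT.2 x hx y hy hxy, hxy⟩

section
variable [DecidableEq V]

theorem noIsolated_sdiff_removed : NoIsolated G (A \ removed G A w) := by
  intro x hx
  rw [Finset.mem_sdiff, mem_removed] at hx
  obtain ⟨hxA, hx⟩ := hx
  push Not at hx
  obtain ⟨h1, y, hyA, hxy, hy⟩ := hx hxA
  refine ⟨y, ?_, hxy⟩
  rw [Finset.mem_sdiff, mem_removed]
  refine ⟨hyA, ?_⟩
  push Not
  exact fun _ => ⟨hy, x, hxA, hxy.symm, h1⟩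

theorem two_le_card_removed (hA : NoIsolated G A) (hw : w ∈ A) : 2 ≤ (removed G A w).card := by
  obtain ⟨y, hy, hwy⟩ := hA w hw
  have : ({w, y} : Finset V) ⊆ removed G A w := by
    intro z hz
    rw [mem_removed]
    grind
  have h2 := Finset.card_le_card this
  rwa [Finset.card_pair hwy.ne] at h2

theorem three_le_card_removed {a b c : V} (ha : a ∈ removed G A w) (hb : b ∈ removed G A w)
    (hc : c ∈ removed G A w) (hab : a ≠ b) (hac : a ≠ c) (hbc : b ≠ c) :
    3 ≤ (removed G A w).card := by
  have : ({a, b, c} : Finset V) ⊆ removed G A w := by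
    intro z hz
    grind
  have h2 := Finset.card_le_card this
  rwa [Finset.card_eq_three.2 ⟨a, b, c, hab, hac, hbc, rfl⟩] at h2

theorem of_removed_eq_singleton (hA : NoIsolated G A) (h : removed G A w = {x}) :
    w ∉ A ∧ x ∈ A ∧ G.Adj w x ∧ (∀ y ∈ A, G.Adj w y → y = x) ∧
      ∀ y ∈ A, y ≠ x → ∃ z ∈ A, G.Adj y z ∧ z ≠ x := by
  have hw : w ∉ A := by
    intro hw
    have := two_le_card_removed hA hw
    simp [h] at this
  have h1 : ∀ y ∈ A, G.Adj w y → y = x := fun y hy hwy => by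
    have : y ∈ removed G A w := mem_removed.2 ⟨hy, Or.inl (Or.inr hwy)⟩
    simpa [h] using this
  obtain ⟨y, hy, h2⟩ := exists_dominated hA (w := w) (by simp [h])
  have hwy : G.Adj w y := h2.resolve_left (by rintro rfl; exact hw hy)
  obtain rfl := h1 y hy hwy
  refine ⟨hw, hy, hwy, h1, fun z hz hzy => ?_⟩
  have h3 : z ∉ removed G A w := by simp [h, hzy]
  rw [mem_removed] at h3
  push Not at h3
  obtain ⟨-, t, ht, hzt, -, hwt⟩ := h3 hz
  exact ⟨t, ht, hzt, by rintro rfl; exact hwt hwy⟩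

theorem ClosedIn.sdiff {T : Finset V} (hT : ClosedIn G A T) : ClosedIn G A (A \ T) := by
  refine ⟨Finset.sdiff_subset, fun x hx y hy hxy => ?_⟩
  rw [Finset.mem_sdiff] at hx ⊢
  exact ⟨hy, fun h => hx.2 (hT.2 y h x hx.1 hxy.symm)⟩

theorem noIsolated_sdiff_of_removed_eq {D : Finset V} (h : removed G A w = D) :
    NoIsolated G (A \ D) :=
  h ▸ noIsolated_sdiff_removed

theorem sdiff_eq_insert_insert {D : Finset V} {p q : V} (hp : p ∈ A) (hq : q ∈ A) (hpD : p ∉ D)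
    (hqD : q ∉ D) : A \ D = insert p (insert q (A \ insert p (insert q D))) := by
  ext z
  simp only [Finset.mem_sdiff, Finset.mem_insert]
  have h1 : z = p → z ∈ A ∧ z ∉ D := by
    rintro rfl
    exact ⟨hp, hpD⟩
  have h2 : z = q → z ∈ A ∧ z ∉ D := by
    rintro rfl
    exact ⟨hq, hqD⟩
  tauto

end

variable {X : Set V} {k : ℕ}

theorem mem_closedNbhdSet_insert {v : V} : x ∈ closedNbhdSet G (insert v X) ↔
    (x = v ∨ G.Adj v x) ∨ x ∈ closedNbhdSet G X := by
  simp only [closedNbhdSet, Set.mem_insert_iff, Set.mem_ofPred_eq, exists_eq_or_imp]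
  tauto

theorem isoGameVal_true_succ_le {v : V} (hv : IsPlayable G X v) :
    isoGameVal G (k + 1) true X ≤ isoGameVal G k false (insert v X) + 1 := by
  rw [isoGameVal, if_pos ⟨v, hv⟩]
  exact Nat.sInf_le ⟨v, hv, rfl⟩

theorem isoGameVal_false_succ_le {m : ℕ}
    (h : ∀ v, IsPlayable G X v → isoGameVal G k true (insert v X) + 1 ≤ m) :
    isoGameVal G (k + 1) false X ≤ m := by
  rw [isoGameVal]
  split_ifs with h1
  · simp_all
  · obtain ⟨v, hv⟩ := h1
    refine csSup_le ⟨_, v, hv, rfl⟩ ?_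
    rintro n ⟨v, hv, rfl⟩
    exact h v hv
  · exact Nat.zero_le _

theorem isoGameVal_eq_zero {b : Bool} (h : ∀ v, ¬ IsPlayable G X v) :
    isoGameVal G k b X = 0 := by
  cases k with
  | zero => rfl
  | succ k =>
    rw [isoGameVal, if_neg]
    push Not
    exact h

variable [Fintype V] {e e' : ℤ}

theorem mem_active : x ∈ active G X ↔
    x ∉ closedNbhdSet G X ∧ ∃ w, G.Adj x w ∧ w ∉ closedNbhdSet G X := by
  simp [active]

theorem noIsolated_active : NoIsolated G (active G X) := by
  intro x hx
  obtain ⟨h, y, hxy, hy⟩ := mem_active.1 hx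
  exact ⟨y, mem_active.2 ⟨hy, x, hxy.symm, h⟩, hxy⟩

theorem active_insert [DecidableEq V] :
    active G (insert w X) = active G X \ removed G (active G X) w := by
  ext x
  simp only [mem_active, Finset.mem_sdiff, mem_removed, mem_closedNbhdSet_insert]
  constructor
  · rintro ⟨h1, y, hxy, hy⟩
    push Not at h1 hy
    refine ⟨⟨h1.2, y, hxy, hy.2⟩, ?_⟩
    push Not
    exact fun _ => ⟨h1.1, y, ⟨hy.2, x, hxy.symm, h1.2⟩, hxy, hy.1⟩
  · rintro ⟨h1, h2⟩
    push Not at h2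
    obtain ⟨h3, y, hy, hxy, hy'⟩ := h2 h1
    refine ⟨?_, y, hxy, ?_⟩
    · push Not
      exact ⟨h3, h1.1⟩
    · push Not
      exact ⟨hy', hy.1⟩

theorem isPlayable_iff [DecidableEq V] {v : V} :
    IsPlayable G X v ↔ (removed G (active G X) v).Nonempty := by
  constructor
  · rintro ⟨u, h1, h2, h3⟩
    exact removed_nonempty_of_dominates (mem_active.2 ⟨h2, h3⟩) h1
  · intro h
    obtain ⟨u, hu, h1⟩ := exists_dominated noIsolated_active h
    exact ⟨u, h1, mem_active.1 hu⟩

theorem active_empty (hG : G.Connected) (hn : 2 ≤ Fintype.card V) :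
    active G ∅ = Finset.univ := by
  have : Nontrivial V := Fintype.one_lt_card_iff_nontrivial.1 (by omega)
  ext x
  obtain ⟨y, hxy⟩ := hG.preconnected.exists_adj_of_nontrivial x
  simp only [mem_active, closedNbhdSet, Finset.mem_univ, iff_true]
  exact ⟨by simp, y, hxy, by simp⟩

theorem DomBound.mono (h : DomBound G A e) (he : e' ≤ e) : DomBound G A e' := by
  intro k X hX
  have := h k X hX
  omega

section
variable [DecidableEq V]

theorem domBound_of_move (hw : (removed G A w).Nonempty)
    (h : StallBound G (A \ removed G A w) e') (he : e ≤ e' + (removed G A w).card - 2) :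
    DomBound G A e := by
  intro k X hX
  subst hX
  have hc := Finset.card_sdiff_add_card_eq_card (removed_subset (G := G) (A := active G X) (w := w))
  have hk : ∀ k, 2 * (isoGameVal G k false (insert w X) : ℤ) + e' ≤
      (active G X \ removed G (active G X) w).card := fun k => h k _ active_insert
  cases k with
  | zero =>
    have h0 := hk 0
    simp only [isoGameVal] at h0 ⊢
    push_cast at *
    omega
  | succ k =>
    have h1 := isoGameVal_true_succ_le (k := k) (isPlayable_iff.2 hw)
    have h2 := hk k
    omega

theorem stallBound_of_moves (hA : e ≤ A.card)
    (h : ∀ w, (removed G A w).Nonempty →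
      DomBound G (A \ removed G A w) (e - (removed G A w).card + 2)) :
    StallBound G A e := by
  intro k X hX
  subst hX
  cases k with
  | zero =>
    simp only [isoGameVal]
    push_cast
    omega
  | succ k =>
    have h1 : isoGameVal G (k + 1) false X ≤ (((active G X).card - e) / 2).toNat := by
      refine isoGameVal_false_succ_le fun v hv => ?_
      have h2 := h v (isPlayable_iff.1 hv) k (insert v X) active_insert
      have hc := Finset.card_sdiff_add_card_eq_card
        (removed_subset (G := G) (A := active G X) (w := v))
      omega
    omega

theorem domBound_empty : DomBound G ∅ 0 := by
  intro k X hX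
  rw [isoGameVal_eq_zero]
  · simp
  · intro v hv
    rw [isPlayable_iff, hX] at hv
    obtain ⟨x, hx⟩ := hv
    simpa using removed_subset hx

theorem basic_bounds (hA : NoIsolated G A) :
    StallBound G A (-1) ∧ DomBound G A 0 ∧
      ((∀ x ∈ A, ∀ y ∈ A, ∀ z ∈ A, G.Adj x y → G.Adj x z → y = z) → StallBound G A 0) := by
  induction hn : A.card using Nat.strong_induction_on generalizing A with
  | _ n ih =>
  subst hn
  have ih' : ∀ w, (removed G A w).Nonempty → _ := fun w hw =>
    ih _ (Finset.card_lt_card (Finset.sdiff_ssubset removed_subset hw))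
      (noIsolated_sdiff_removed (G := G) (A := A) (w := w)) rfl
  refine ⟨?_, ?_, ?_⟩
  · refine stallBound_of_moves (by omega) fun w hw => (ih' w hw).2.1.mono ?_
    have := hw.card_pos
    omega
  · by_cases hm : ∀ x ∈ A, ∀ y ∈ A, ∀ z ∈ A, G.Adj x y → G.Adj x z → y = z
    · obtain rfl | ⟨w, hw⟩ := A.eq_empty_or_nonempty
      · exact domBound_empty
      · have h2 := two_le_card_removed hA hw
        have hne : (removed G A w).Nonempty := Finset.card_pos.1 (by omega)
        refine domBound_of_move hne ((ih' w hne).2.2 ?_) (by omega)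
        intro x hx y hy z hz
        exact hm x (Finset.mem_sdiff.1 hx).1 y (Finset.mem_sdiff.1 hy).1 z (Finset.mem_sdiff.1 hz).1
    · push Not at hm
      obtain ⟨w, hw, y, hy, z, hz, hwy, hwz, hyz⟩ := hm
      have h3 : 3 ≤ (removed G A w).card := three_le_card_removed
        (mem_removed.2 ⟨hw, Or.inl (Or.inl rfl)⟩) (mem_removed.2 ⟨hy, Or.inl (Or.inr hwy)⟩)
        (mem_removed.2 ⟨hz, Or.inl (Or.inr hwz)⟩) hwy.ne hwz.ne hyz
      have hne : (removed G A w).Nonempty := Finset.card_pos.1 (by omega)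
      exact domBound_of_move hne (ih' w hne).1 (by omega)
  · intro hm
    refine stallBound_of_moves (by omega) fun w hw => (ih' w hw).2.1.mono ?_
    have h2 : 2 ≤ (removed G A w).card := by
      obtain ⟨x, hx, hwx⟩ := exists_dominated hA hw
      obtain ⟨y, hy, hxy⟩ := hA x hx
      have : ({x, y} : Finset V) ⊆ removed G A w := by
        intro z hz
        rw [mem_removed]
        have := hm y hy x hx
        have := hxy.symm
        grind
      have h2 := Finset.card_le_card this
      rwa [Finset.card_pair hxy.ne] at h2
    omega

theorem domBound_one_of_four_le (h : 4 ≤ (removed G A w).card) : DomBound G A 1 := by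
  refine domBound_of_move (w := w) (Finset.card_pos.1 (by omega))
    (basic_bounds noIsolated_sdiff_removed).1 ?_
  omega

theorem domBound_one_of_four {a b c d : V} (ha : a ∈ removed G A w) (hb : b ∈ removed G A w)
    (hc : c ∈ removed G A w) (hd : d ∈ removed G A w) (hab : a ≠ b) (hac : a ≠ c) (had : a ≠ d)
    (hbc : b ≠ c) (hbd : b ≠ d) (hcd : c ≠ d) : DomBound G A 1 := by
  apply domBound_one_of_four_le (w := w)
  have : ({a, b, c, d} : Finset V) ⊆ removed G A w := by
    intro z hz
    grind
  have h2 := Finset.card_le_card this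
  have : ({a, b, c, d} : Finset V).card = 4 := by
    simp [*]
  omega

theorem domBound_one_of_three {a b c : V} (ha : a ∈ removed G A w) (hb : b ∈ removed G A w)
    (hc : c ∈ removed G A w) (hab : a ≠ b) (hac : a ≠ c) (hbc : b ≠ c)
    (h : removed G A w = {a, b, c} → StallBound G (A \ {a, b, c}) 0) : DomBound G A 1 := by
  by_cases h4 : 4 ≤ (removed G A w).card
  · exact domBound_one_of_four_le h4
  have hs : ({a, b, c} : Finset V) ⊆ removed G A w := by
    intro z hz
    grind
  have h3 : ({a, b, c} : Finset V).card = 3 := Finset.card_eq_three.2 ⟨a, b, c, hab, hac, hbc, rfl⟩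
  have he : {a, b, c} = removed G A w := Finset.eq_of_subset_of_card_le hs (by omega)
  have h' := h he.symm
  rw [he] at h'
  refine domBound_of_move ⟨a, ha⟩ h' ?_
  rw [← he, h3]
  norm_num

theorem stallBound_zero (h : ∀ w x, removed G A w = {x} → DomBound G (A \ {x}) 1) :
    StallBound G A 0 := by
  refine stallBound_of_moves (by omega) fun w hw => ?_
  have h1 := hw.card_pos
  by_cases h2 : (removed G A w).card = 1
  · obtain ⟨x, hx⟩ := Finset.card_eq_one.1 h2
    rw [h2, hx]
    exact (h w x hx).mono (by norm_num)
  · exact (basic_bounds noIsolated_sdiff_removed).2.1.mono (by omega)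

theorem domBound_one_of_path {p q r s : V} (hp : p ∈ A) (hq : q ∈ A) (hr : r ∈ A) (hs : s ∈ A)
    (hqr : G.Adj q r) (hrs : G.Adj r s) (hqs : q ≠ s) (hpr : p ≠ r) (hpq : p ≠ q)
    (hleaf : ∀ y ∈ A, G.Adj p y → y = q) : DomBound G A 1 := by
  have hps : p ≠ s := by
    rintro rfl
    exact hqr.ne (hleaf r hr hrs.symm).symm
  refine domBound_one_of_four (w := r) (a := p) (b := q) (c := r) (d := s) ?_ ?_ ?_ ?_
    hpq hpr hps hqr.ne hqs hrs.ne
  · refine mem_removed.2 ⟨hp, Or.inr fun y hy h => ?_⟩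
    rw [hleaf y hy h]
    exact Or.inr hqr.symm
  · exact mem_removed.2 ⟨hq, Or.inl (Or.inr hqr.symm)⟩
  · exact mem_removed.2 ⟨hr, Or.inl (Or.inl rfl)⟩
  · exact mem_removed.2 ⟨hs, Or.inl (Or.inr hrs)⟩

/-- The position in which a leaf `v` with neighbor `u` has been selected, `A` is the set of all
other vertices, and every component of the subgraph induced by `A` contains a neighbor of `u`. -/
structure LeafPosition (G : SimpleGraph V) (A : Finset V) (u v : V) : Prop where
  noIsolated : NoIsolated G A
  cover : ∀ w, w = u ∨ w = v ∨ w ∈ A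
  notMem : u ∉ A
  leaf : ∀ y ∈ A, ¬ G.Adj v y
  touch : ∀ T, ClosedIn G A T → T.Nonempty → ∃ x ∈ T, G.Adj u x

variable {u v : V}

theorem eq_of_adj_of_not_domBound (hb : ¬ DomBound G A 1) {y z t : V} (hx : x ∈ A)
    (hy : y ∈ A) (hz : z ∈ A) (ht : t ∈ A) (hxy : G.Adj x y) (hxz : G.Adj x z) (hxt : G.Adj x t)
    (hyz : y ≠ z) : t = y ∨ t = z := by
  by_contra! h
  exact hb <| domBound_one_of_four (w := x) (mem_removed.2 ⟨hx, Or.inl (Or.inl rfl)⟩)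
    (mem_removed.2 ⟨hy, Or.inl (Or.inr hxy)⟩) (mem_removed.2 ⟨hz, Or.inl (Or.inr hxz)⟩)
    (mem_removed.2 ⟨ht, Or.inl (Or.inr hxt)⟩) hxy.ne hxz.ne hxt.ne hyz h.1.symm h.2.symm

theorem domBound_one_of_square {a b c d : V} (ha : a ∈ A) (hb : b ∈ A) (hc : c ∈ A) (hd : d ∈ A)
    (hab : G.Adj a b) (hbc : G.Adj b c) (hcd : G.Adj c d) (hda : G.Adj d a) (hac : a ≠ c)
    (hbd : b ≠ d) : DomBound G A 1 := by
  by_contra h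
  refine h <| domBound_one_of_four (w := a) (mem_removed.2 ⟨ha, Or.inl (Or.inl rfl)⟩)
    (mem_removed.2 ⟨hb, Or.inl (Or.inr hab)⟩) (mem_removed.2 ⟨hc, Or.inr fun y hy hcy => ?_⟩)
    (mem_removed.2 ⟨hd, Or.inl (Or.inr hda.symm)⟩) hab.ne hac hda.ne' hbc.ne hbd hcd.ne
  obtain rfl | rfl := eq_of_adj_of_not_domBound h hc hb hd hy hbc.symm hcd hcy hbd
  · exact Or.inr hab
  · exact Or.inr hda.symm

theorem LeafPosition.stallBound_closed (hP : LeafPosition G A u v) (hb : ¬ DomBound G A 1)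
    {T : Finset V} (hT : ClosedIn G A T)
    (h3 : ∀ a b c, G.Adj a b → G.Adj b c → a ≠ c → ClosedIn G A {a, b, c} → T ≠ {a, b, c}) :
    StallBound G T 0 := by
  refine stallBound_zero fun w x hwx => ?_
  obtain ⟨hw, hx, hadj, honly, hother⟩ := of_removed_eq_singleton (hT.noIsolated hP.noIsolated) hwx
  have hxA := hT.1 hx
  obtain rfl : w = u := by
    obtain h | rfl | h := hP.cover w
    · exact h
    · exact absurd hadj (hP.leaf x hxA)
    · exact absurd (hT.2 x hx w h hadj.symm) hw
  have hdeg := fun x y z t => eq_of_adj_of_not_domBound (x := x) (y := y) (z := z) (t := t) hb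
  have hpath := fun p q r s => mt (domBound_one_of_path (A := A) (G := G) (p := p) (q := q)
    (r := r) (s := s))
  have key : ∀ a b c, G.Adj a b → G.Adj b c → a ≠ c → a ∈ T → b ∈ T → c ∈ T →
      x ∈ ({a, b, c} : Finset V) → ¬ ClosedIn G A {a, b, c} := by
    intro a b c hab hbc hac ha hb hc hx3 hcl
    refine h3 a b c hab hbc hac hcl (Finset.Subset.antisymm ?_ ?_)
    · rw [← Finset.sdiff_eq_empty_iff_subset, ← Finset.not_nonempty_iff_eq_empty]
      intro hne
      obtain ⟨y, hy, hwy⟩ := hP.touch (T \ {a, b, c}) ⟨fun z hz => hT.1 (Finset.mem_sdiff.1 hz).1,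
        fun y hy z hz hyz => Finset.mem_sdiff.2 ⟨hT.2 y (Finset.mem_sdiff.1 hy).1 z hz hyz,
          fun h => (hcl.sdiff.2 y (by grind [hT.1]) z hz hyz |> Finset.mem_sdiff.1).2 h⟩⟩ hne
      rw [Finset.mem_sdiff] at hy
      exact hy.2 (honly y hy.1 hwy ▸ hx3)
    · intro z hz
      grind
  obtain ⟨a1, ha1, hxa1⟩ := hT.noIsolated hP.noIsolated x hx
  obtain ⟨a2, ha2, ha12, ha2x⟩ := hother a1 ha1 hxa1.ne'
  have ha1A := hT.1 ha1
  have ha2A := hT.1 ha2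
  by_cases hlx : ∀ y ∈ A, G.Adj x y → y = a1
  · exfalso
    refine key x a1 a2 hxa1 ha12 ha2x.symm hx ha1 ha2 (by simp) ⟨?_, ?_⟩
    · intro z hz
      grind
    · intro y hy z hz hyz
      simp only [Finset.mem_insert, Finset.mem_singleton] at hy ⊢
      obtain rfl | rfl | rfl := hy
      · exact Or.inr (Or.inl (hlx z hz hyz))
      · have := hdeg y x a2 z ha1A hxA ha2A hz hxa1.symm ha12 hyz ha2x.symm
        tauto
      · by_contra! hne
        exact hb (domBound_one_of_path hxA ha1A ha2A hz ha12 hyz hne.2.1.symm ha2x.symm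
          hxa1.ne hlx)
  push Not at hlx
  obtain ⟨b1, hb1A, hxb1, hab1⟩ := hlx
  have hb1 := hT.2 x hx b1 hb1A hxb1
  have hNx : ∀ t ∈ A, G.Adj x t → t = a1 ∨ t = b1 := fun t ht hxt =>
    hdeg x a1 b1 t hxA ha1A hb1A ht hxa1 hxb1 hxt hab1.symm
  have hNa1 : ∀ t ∈ A, G.Adj a1 t → t = x ∨ t = a2 := fun t ht h =>
    hdeg a1 x a2 t ha1A hxA ha2A ht hxa1.symm ha12 h ha2x.symm
  by_cases hab2 : a2 = b1
  · subst hab2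
    exfalso
    refine key a1 x a2 hxa1.symm hxb1 hab1.symm ha1 hx ha2 (by simp) ⟨?_, ?_⟩
    · intro z hz
      grind
    · intro y hy z hz hyz
      simp only [Finset.mem_insert, Finset.mem_singleton] at hy ⊢
      obtain rfl | rfl | rfl := hy
      · have := hNa1 z hz hyz
        tauto
      · have := hNx z hz hyz
        tauto
      · have := hdeg y x a1 z ha2A hxA ha1A hz hxb1.symm ha12.symm hyz hxa1.ne
        tauto
  have hxa2 : ¬ G.Adj x a2 := fun h => by
    obtain h | h := hNx a2 ha2A h
    · exact ha12.ne h.symm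
    · exact hab2 h
  obtain ⟨a3, ha3A, ha23, ha31⟩ : ∃ t ∈ A, G.Adj a2 t ∧ t ≠ a1 := by
    by_contra! hl
    exact hb (domBound_one_of_path ha2A ha1A hxA hb1A hxa1.symm hxb1 hab1.symm ha2x ha12.ne' hl)
  have ha3x : a3 ≠ x := by
    rintro rfl
    exact hxa2 ha23.symm
  obtain ⟨a4, ha4A, ha34, ha42⟩ : ∃ t ∈ A, G.Adj a3 t ∧ t ≠ a2 := by
    by_contra! hl
    exact hb (domBound_one_of_path ha3A ha2A ha1A hxA ha12.symm hxa1.symm ha2x ha31 ha23.ne' hl)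
  have ha4x : a4 ≠ x := by
    rintro rfl
    obtain h | rfl := hNx a3 ha3A ha34.symm
    · exact ha31 h
    · exact hb (domBound_one_of_square hxA ha1A ha2A ha3A hxa1 ha12 ha23 ha34 ha2x.symm ha31.symm)
  have ha3 := hT.2 a2 ha2 a3 ha3A ha23
  have ha4 := hT.2 a3 ha3 a4 ha4A ha34
  refine domBound_one_of_path (p := a1) (q := a2) (r := a3) (s := a4) ?_ ?_ ?_ ?_ ha23 ha34
    ha42.symm ha31.symm ha12.ne ?_
  · simp [ha1, hxa1.ne']
  · simp [ha2, ha2x]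
  · simp [ha3, ha3x]
  · simp [ha4, ha4x]
  · intro y hy h
    rw [Finset.mem_sdiff, Finset.mem_singleton] at hy
    exact (hNa1 y (hT.1 hy.1) h).resolve_left hy.2

theorem LeafPosition.not_closedIn_triple (hP : LeafPosition G A u v) (hb : ¬ DomBound G A 1)
    (hc : 7 ≤ A.card) {a b c : V} (hab : G.Adj a b) (hbc : G.Adj b c) (hac : a ≠ c) :
    ¬ ClosedIn G A {a, b, c} := by
  intro hcl
  have hsub := hcl.1
  refine hb (domBound_one_of_three (w := b) (a := a) (b := b) (c := c) ?_ ?_ ?_ hab.ne hac hbc.ne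
    fun _ => hP.stallBound_closed hb hcl.sdiff fun a' b' c' _ _ _ _ h => ?_)
  · exact mem_removed.2 ⟨hsub (by simp), Or.inl (Or.inr hab.symm)⟩
  · exact mem_removed.2 ⟨hsub (by simp), Or.inl (Or.inl rfl)⟩
  · exact mem_removed.2 ⟨hsub (by simp), Or.inl (Or.inr hbc)⟩
  · have h1 := Finset.card_sdiff_add_card_eq_card hsub
    have h2 : ({a, b, c} : Finset V).card ≤ 3 := Finset.card_le_three
    have h3 : ({a', b', c'} : Finset V).card ≤ 3 := Finset.card_le_three
    rw [h] at h1
    omega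

theorem LeafPosition.exists_next (hP : LeafPosition G A u v) (hb : ¬ DomBound G A 1)
    (hc : 7 ≤ A.card) {x y z : V} (hx : x ∈ A) (hy : y ∈ A) (hz : z ∈ A) (hzx : G.Adj z x)
    (hxy : G.Adj x y) (hzy : z ≠ y) :
    ∃ t ∈ A, G.Adj y t ∧ t ≠ x ∧ ∀ s ∈ A, G.Adj y s → s = x ∨ s = t := by
  by_cases h : ∃ t ∈ A, G.Adj y t ∧ t ≠ x
  · obtain ⟨t, ht, hyt, htx⟩ := h
    exact ⟨t, ht, hyt, htx, fun s hs hys =>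
      eq_of_adj_of_not_domBound hb hy hx ht hs hxy.symm hyt hys htx.symm⟩
  push Not at h
  exfalso
  refine hP.not_closedIn_triple hb hc hzx hxy hzy ⟨?_, ?_⟩
  · intro t ht
    grind
  · intro t ht s hs hts
    simp only [Finset.mem_insert, Finset.mem_singleton] at ht ⊢
    obtain rfl | rfl | rfl := ht
    · by_contra! hne
      exact hb (domBound_one_of_path hy hx hz hs hzx.symm hts hne.2.1.symm hzy.symm hxy.ne' h)
    · have := eq_of_adj_of_not_domBound hb hx hz hy hs hzx.symm hxy hts hzy
      tauto
    · exact Or.inr (Or.inl (h s hs hts))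

/-- A move of Staller removing a single vertex is made at `u` or at a vertex removed before. -/
theorem LeafPosition.of_removed_sdiff_eq_singleton (hP : LeafPosition G A u v) {D : Finset V}
    (hD : NoIsolated G (A \ D)) (h : removed G (A \ D) w = {x}) :
    (w = u ∨ w ∈ D) ∧ x ∈ A ∧ x ∉ D ∧ G.Adj w x ∧ (∀ y ∈ A, y ∉ D → G.Adj w y → y = x) ∧
      ∀ y ∈ A, y ∉ D → y ≠ x → ∃ z ∈ A, z ∉ D ∧ G.Adj y z ∧ z ≠ x := by
  obtain ⟨h1, h2, h3, h4, h5⟩ := of_removed_eq_singleton hD h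
  rw [Finset.mem_sdiff] at h1 h2
  refine ⟨?_, h2.1, h2.2, h3, fun y hy hyD => h4 y (Finset.mem_sdiff.2 ⟨hy, hyD⟩), ?_⟩
  · obtain h | rfl | h := hP.cover w
    · exact Or.inl h
    · exact absurd h3 (hP.leaf x h2.1)
    · exact Or.inr (by_contra fun h' => h1 ⟨h, h'⟩)
  · intro y hy hyD hyx
    obtain ⟨z, hz, h6⟩ := h5 y (Finset.mem_sdiff.2 ⟨hy, hyD⟩) hyx
    rw [Finset.mem_sdiff] at hz
    exact ⟨z, hz.1, hz.2, h6⟩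

/-- Dominator answers at `u` when an edge at `u` and further whole components remain. -/
theorem LeafPosition.domBound_one_of_edge (hP : LeafPosition G A u v) (hb : ¬ DomBound G A 1)
    (hc : 7 ≤ A.card) {T : Finset V} {p q : V} (hT : ClosedIn G A T) (hne : T.Nonempty)
    (hp : p ∈ A) (hq : q ∈ A) (hpT : p ∉ T) (hqT : q ∉ T) (hpq : G.Adj p q) (hup : G.Adj u p) :
    DomBound G (insert p (insert q T)) 1 := by
  obtain ⟨d, hd, hud⟩ := hP.touch T hT hne
  have hdA := hT.1 hd
  have hdp : p ≠ d := fun h => hpT (h ▸ hd)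
  have hdq : q ≠ d := fun h => hqT (h ▸ hd)
  refine domBound_one_of_three (w := u) (a := p) (b := q) (c := d)
    (mem_removed_of_adj (by simp) hup) ?_ (mem_removed_of_adj (by simp [hd]) hud) hpq.ne
    hdp hdq fun hr => stallBound_zero fun w x h => ?_
  · refine mem_removed.2 ⟨by simp, Or.inr fun y hy hqy => ?_⟩
    rw [Finset.mem_insert, Finset.mem_insert] at hy
    obtain rfl | rfl | hy := hy
    · exact Or.inr hup
    · exact absurd rfl hqy.ne
    · exact absurd (hT.2 y hy q hq hqy.symm) hqT
  exfalso
  have hset : insert p (insert q T) \ {p, q, d} = T \ {d} := by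
    ext z
    simp only [Finset.mem_sdiff, Finset.mem_insert, Finset.mem_singleton]
    constructor
    · tauto
    · rintro ⟨h1, h2⟩
      have h3 : z ≠ p := fun h => hpT (h ▸ h1)
      have h4 : z ≠ q := fun h => hqT (h ▸ h1)
      tauto
  have hni := noIsolated_sdiff_of_removed_eq hr
  rw [hset] at hni h
  obtain ⟨h1, h2, h3, h4, -⟩ := of_removed_eq_singleton hni h
  rw [Finset.mem_sdiff, Finset.mem_singleton] at h1 h2
  have hxA := hT.1 h2.1
  have hx3 : x ∉ removed G (insert p (insert q T)) u := by
    rw [hr]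
    simp only [Finset.mem_insert, Finset.mem_singleton]
    rintro (rfl | rfl | rfl)
    · exact hpT h2.1
    · exact hqT h2.1
    · exact h2.2 rfl
  have hxI : x ∈ insert p (insert q T) := by simp [h2.1]
  obtain rfl | rfl | hw := hP.cover w
  · exact hx3 (mem_removed_of_adj hxI h3)
  · exact hP.leaf x hxA h3
  have hwT := hT.2 x h2.1 w hw h3.symm
  obtain rfl : w = d := by_contra fun h => h1 ⟨hwT, h⟩
  have hwx : ∀ y ∈ A, G.Adj w y → y = x := fun y hy hwy =>
    h4 y (by simpa [hwy.ne'] using hT.2 w hwT y hy hwy) hwy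
  refine hx3 (mem_removed.2 ⟨hxI, Or.inr fun y hy hxy => ?_⟩)
  have hyA : y ∈ A := by
    rw [Finset.mem_insert, Finset.mem_insert] at hy
    obtain rfl | rfl | hy := hy
    · exact hp
    · exact hq
    · exact hT.1 hy
  by_cases hyw : y = w
  · exact Or.inr (hyw ▸ hud)
  · obtain ⟨t, ht, hwt, htx, -⟩ := hP.exists_next hb hc hxA hdA hyA hxy.symm h3.symm hyw
    exact absurd (hwx t ht hwt) htx

theorem LeafPosition.exists_adj_with_two_neighbors (hP : LeafPosition G A u v)
    (hb : ¬ DomBound G A 1) (hc : 7 ≤ A.card) : ∃ c ∈ A, G.Adj u c ∧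
      ∃ a b, a ∈ A ∧ b ∈ A ∧ G.Adj c a ∧ G.Adj c b ∧ a ≠ b := by
  classical
  set T := A.filter fun c => ∃ a b, a ∈ A ∧ b ∈ A ∧ G.Adj c a ∧ G.Adj c b ∧ a ≠ b with hT
  have hclT : ClosedIn G A T := by
    refine ⟨Finset.filter_subset _ _, ?_⟩
    intro x hx y hy hxy
    rw [hT, Finset.mem_filter] at hx ⊢
    obtain ⟨hx, a, b, ha, hbA, hxa, hxb, hab⟩ := hx
    obtain ⟨z, hz, hxz, hzy⟩ : ∃ z ∈ A, G.Adj x z ∧ z ≠ y := by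
      by_cases hay : a = y
      · exact ⟨b, hbA, hxb, fun h => hab (hay.trans h.symm)⟩
      · exact ⟨a, ha, hxa, hay⟩
    obtain ⟨t, ht, hyt, htx, -⟩ := hP.exists_next hb hc hx hy hz hxz.symm hxy hzy
    exact ⟨hy, x, t, hx, ht, hxy.symm, hyt, htx.symm⟩
  have hneT : T.Nonempty := by
    by_contra hne
    rw [hT, Finset.not_nonempty_iff_eq_empty, Finset.filter_eq_empty_iff] at hne
    push Not at hne
    refine hb (domBound_one_of_four_le (w := u) ?_)
    have : A ⊆ removed G A u := by
      intro x hx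
      obtain ⟨y, hy, hxy⟩ := hP.noIsolated x hx
      have hNx : ∀ z ∈ A, G.Adj x z → z = y := fun z hz hxz => hne hx z y hz hy hxz hxy
      have hNy : ∀ z ∈ A, G.Adj y z → z = x := fun z hz hyz => hne hy z x hz hx hyz hxy.symm
      obtain ⟨t, ht, hut⟩ := hP.touch {x, y} ⟨by grind, by grind⟩ (by simp)
      simp only [Finset.mem_insert, Finset.mem_singleton] at ht
      obtain rfl | rfl := ht
      · exact mem_removed_of_adj hx hut
      · refine mem_removed.2 ⟨hx, Or.inr fun z hz hxz => ?_⟩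
        rw [hNx z hz hxz]
        exact Or.inr hut
    have := Finset.card_le_card this
    omega
  obtain ⟨c, hcT, huc⟩ := hP.touch T hclT hneT
  rw [hT, Finset.mem_filter] at hcT
  exact ⟨c, hcT.1, huc, hcT.2⟩

set_option maxHeartbeats 800000 in
theorem LeafPosition.domBound_one (hP : LeafPosition G A u v) (hc : 7 ≤ A.card) :
    DomBound G A 1 := by
  by_contra hb
  have hclosed : ∀ T, ClosedIn G A T → StallBound G T 0 := fun T hT =>
    hP.stallBound_closed hb hT fun a b c h1 h2 h3 h4 => absurd h4 (hP.not_closedIn_triple hb hc h1 h2 h3)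
  obtain ⟨c0, hc0, huc0, a1, b1, ha1, hb1, hca1, hcb1, hab1⟩ :=
    hP.exists_adj_with_two_neighbors hb hc
  have hNc0 : ∀ t ∈ A, G.Adj c0 t → t = a1 ∨ t = b1 := fun t ht h =>
    eq_of_adj_of_not_domBound hb hc0 ha1 hb1 ht hca1 hcb1 h hab1
  obtain ⟨a2, ha2, ha12, ha2c, hNa1⟩ := hP.exists_next hb hc hc0 ha1 hb1 hcb1.symm hca1 hab1.symm
  obtain ⟨b2, hb2, hb12, hb2c, hNb1⟩ := hP.exists_next hb hc hc0 hb1 ha1 hca1.symm hcb1 hab1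
  have ha2b1 : a2 ≠ b1 := by
    rintro rfl
    refine hP.not_closedIn_triple hb hc hca1.symm hcb1 hab1 ⟨by grind, fun y hy z hz hyz => ?_⟩
    have := hNb1 a1 ha1 ha12.symm
    have := hca1.ne
    simp only [Finset.mem_insert, Finset.mem_singleton] at hy ⊢
    obtain rfl | rfl | rfl := hy
    · have := hNa1 z hz hyz
      tauto
    · have := hNc0 z hz hyz
      tauto
    · have := hNb1 z hz hyz
      grind
  have hb2a1 : b2 ≠ a1 := by
    rintro rfl
    have := hNa1 b1 hb1 hb12.symm
    have := hcb1.ne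
    grind
  have hab2 : a2 ≠ b2 := by
    rintro rfl
    exact hb (domBound_one_of_square hc0 ha1 ha2 hb1 hca1 ha12 hb12.symm hcb1.symm ha2c.symm hab1)
  obtain ⟨a3, ha3, ha23, ha31, hNa2⟩ := hP.exists_next hb hc ha1 ha2 hc0 hca1 ha12 ha2c.symm
  obtain ⟨b3, hb3, hb23, hb31, hNb2⟩ := hP.exists_next hb hc hb1 hb2 hc0 hcb1 hb12 hb2c.symm
  have hne0 := hca1.ne
  have hne1 := hcb1.ne
  have hne2 := ha12.ne
  have hne3 := hb12.ne
  have hne4 := ha23.ne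
  have hne5 := hb23.ne
  have hc0a3 : c0 ≠ a3 := by
    rintro rfl
    have := hNc0 a2 ha2 ha23.symm
    grind
  have hb1a3 : b1 ≠ a3 := by
    rintro rfl
    have := hNb1 a2 ha2 ha23.symm
    grind
  have hc0b3 : c0 ≠ b3 := by
    rintro rfl
    have := hNc0 b2 hb2 hb23.symm
    grind
  have ha1b3 : a1 ≠ b3 := by
    rintro rfl
    have := hNa1 b2 hb2 hb23.symm
    grind
  -- Dominator's move at `a2`.
  have hplay : ¬ ∀ w x, (x = c0 ∨ (w = a3 ∧ x ≠ a2 ∧ G.Adj a3 x)) →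
      (∀ y ∈ A, y ∉ ({a1, a2, a3} : Finset V) → y ≠ x →
        ∃ z ∈ A, z ∉ ({a1, a2, a3} : Finset V) ∧ G.Adj y z ∧ z ≠ x) →
      x ∈ A → x ∉ ({a1, a2, a3} : Finset V) →
      DomBound G ((A \ {a1, a2, a3}) \ {x}) 1 := by
    intro hw
    refine hb (domBound_one_of_three (w := a2) (mem_removed_of_adj ha1 ha12.symm)
      (mem_removed_self ha2) (mem_removed_of_adj ha3 ha23) ha12.ne ha31.symm ha23.ne
      fun hr => stallBound_zero fun w x h => ?_)
    obtain ⟨h1, h2, h3, h4, h5, h6⟩ := hP.of_removed_sdiff_eq_singleton (noIsolated_sdiff_of_removed_eq hr) h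
    refine hw w x ?_ h6 h2 h3
    simp only [Finset.mem_insert, Finset.mem_singleton] at h1 h3 h5
    obtain rfl | rfl | rfl | rfl := h1
    · exact Or.inl (h5 c0 hc0 (by grind) huc0).symm
    · exact Or.inl (h5 c0 hc0 (by grind) hca1.symm).symm
    · have := hNa2 x h2 h4
      tauto
    · exact Or.inr ⟨rfl, by tauto, h4⟩
  by_cases h5 : a3 = b2
  · -- cycle of length five
    subst h5
    apply hplay
    clear hplay
    intro w x hx hother hxA hxD
    exfalso
    have hNb2' := hNb2 a2 ha2 ha23.symm
    have hx' : x = c0 ∨ x = b1 := by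
      obtain h | ⟨-, h1, h2⟩ := hx
      · exact Or.inl h
      · have := hNb2 x hxA h2
        grind
    obtain rfl | rfl := hx'
    · obtain ⟨z, hz, hzD, h, hzx⟩ := hother b1 hb1 (by grind) (by grind)
      have := hNb1 z hz h
      grind
    · obtain ⟨z, hz, hzD, h, hzx⟩ := hother c0 hc0 (by grind) (by grind)
      have := hNc0 z hz h
      grind
  have hb3a2 : b3 ≠ a2 := by
    rintro rfl
    have := hNa2 b2 hb2 hb23.symm
    grind
  by_cases h6 : a3 = b3
  · -- cycle of length six
    subst h6
    have hNa3 : ∀ t ∈ A, G.Adj a3 t → t = a2 ∨ t = b2 := fun t ht h =>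
      eq_of_adj_of_not_domBound hb ha3 ha2 hb2 ht ha23.symm hb23.symm h hab2
    have hcyc : ClosedIn G A {c0, a1, b1, a2, b2, a3} := by
      refine ⟨by clear hplay; grind, fun y hy z hz hyz => ?_⟩
      simp only [Finset.mem_insert, Finset.mem_singleton] at hy ⊢
      obtain rfl | rfl | rfl | rfl | rfl | rfl := hy
      · have := hNc0 z hz hyz
        tauto
      · have := hNa1 z hz hyz
        tauto
      · have := hNb1 z hz hyz
        tauto
      · have := hNa2 z hz hyz
        tauto
      · have := hNb2 z hz hyz
        tauto
      · have := hNa3 z hz hyz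
        tauto
    have hrest : (A \ {c0, a1, b1, a2, b2, a3}).Nonempty := by
      rw [← Finset.card_pos]
      have h1 := Finset.card_sdiff_add_card_eq_card hcyc.1
      have h2 : ({c0, a1, b1, a2, b2, a3} : Finset V).card ≤ 6 := Finset.card_le_six
      omega
    have hset_b : ({c0, a1, b1, a2, b2, a3} : Finset V) =
        insert c0 (insert b1 ({a2, a3, b2} ∪ {a1})) := by
      ext z
      simp only [Finset.mem_insert, Finset.mem_union, Finset.mem_singleton]
      tauto
    have hset_a : ({c0, a1, b1, a2, b2, a3} : Finset V) =
        insert c0 (insert a1 ({a2, a3, b2} ∪ {b1})) := by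
      ext z
      simp only [Finset.mem_insert, Finset.mem_union, Finset.mem_singleton]
      tauto
    refine hb (domBound_one_of_three (w := a3) (mem_removed_of_adj ha2 ha23.symm)
      (mem_removed_self ha3) (mem_removed_of_adj hb2 hb23.symm) ha23.ne hab2 hb23.ne'
      fun hr => stallBound_zero fun w x h => ?_)
    obtain ⟨h1, h2, h3, h4, h5, h6⟩ := hP.of_removed_sdiff_eq_singleton (noIsolated_sdiff_of_removed_eq hr) h
    simp only [Finset.mem_insert, Finset.mem_singleton] at h1
    obtain rfl | rfl | rfl | rfl := h1
    · exfalso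
      obtain rfl := h5 c0 hc0 (by grind) huc0
      obtain ⟨z, hz, hzD, h, hzx⟩ := h6 a1 ha1 (by grind) (by grind)
      have := hNa1 z hz h
      grind
    · have := hNa2 x h2 h4
      have hxa : x = a1 := by grind
      rw [hxa]
      rw [sdiff_sdiff_left, Finset.sup_eq_union, sdiff_eq_insert_insert hc0 hb1 ?_ ?_, ← hset_b]
      · exact hP.domBound_one_of_edge hb hc hcyc.sdiff hrest hc0 hb1 (by simp) (by simp) hcb1 huc0
      all_goals
        simp only [Finset.mem_union, Finset.mem_insert, Finset.mem_singleton]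
        clear hplay
        grind
    · exfalso
      have := hNa3 x h2 h4
      grind
    · have := hNb2 x h2 h4
      have hxb : x = b1 := by grind
      rw [hxb]
      rw [sdiff_sdiff_left, Finset.sup_eq_union, sdiff_eq_insert_insert hc0 ha1 ?_ ?_, ← hset_a]
      · exact hP.domBound_one_of_edge hb hc hcyc.sdiff hrest hc0 ha1 (by simp) (by simp) hca1 huc0
      all_goals
        simp only [Finset.mem_union, Finset.mem_insert, Finset.mem_singleton]
        clear hplay
        grind
  obtain ⟨a4, ha4, ha34, ha42, hNa3⟩ := hP.exists_next hb hc ha2 ha3 ha1 ha12 ha23 ha31.symm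
  obtain ⟨b4, hb4, hb34, hb42, hNb3⟩ := hP.exists_next hb hc hb2 hb3 hb1 hb12 hb23 hb31.symm
  have hne6 := hb34.ne
  have hne7 := ha34.ne
  by_cases h7 : a4 = b3
  · -- cycle of length seven
    subst h7
    have hb4a3 : a3 = b4 := (hNb3 a3 ha3 ha34.symm).resolve_left h5
    subst hb4a3
    have hcyc : ClosedIn G A {c0, a1, b1, a2, b2, a3, a4} := by
      refine ⟨by clear hplay; grind, fun y hy z hz hyz => ?_⟩
      simp only [Finset.mem_insert, Finset.mem_singleton] at hy ⊢
      obtain rfl | rfl | rfl | rfl | rfl | rfl | rfl := hy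
      · have := hNc0 z hz hyz
        tauto
      · have := hNa1 z hz hyz
        tauto
      · have := hNb1 z hz hyz
        tauto
      · have := hNa2 z hz hyz
        tauto
      · have := hNb2 z hz hyz
        tauto
      · have := hNa3 z hz hyz
        tauto
      · have := hNb3 z hz hyz
        tauto
    apply hplay
    clear hplay
    intro w x hx hother hxA hxD
    have hx' : x = c0 ∨ x = a4 := by
      obtain h | ⟨-, h1, h2⟩ := hx
      · exact Or.inl h
      · have := hNa3 x hxA h2
        grind
    obtain rfl | rfl := hx'
    · refine domBound_one_of_three (w := b2) (a := b1) (b := b2) (c := a4)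
        (mem_removed_of_adj (by grind) hb12.symm) (mem_removed_self (by grind))
        (mem_removed_of_adj (by grind) hb23) hb12.ne hb31.symm hb23.ne fun _ => ?_
      convert hclosed _ hcyc.sdiff using 1
      grind
    · refine domBound_one_of_three (w := b1) (a := c0) (b := b1) (c := b2)
        (mem_removed_of_adj (by grind) hcb1.symm) (mem_removed_self (by grind))
        (mem_removed_of_adj (by grind) hb12) hcb1.ne hb2c.symm hb12.ne fun _ => ?_
      convert hclosed _ hcyc.sdiff using 1
      grind
  -- cycle of length at least eight
  have hb4a3 : b4 ≠ a3 := by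
    rintro rfl
    have := hNa3 b3 hb3 hb34.symm
    grind
  have ha4c0 : a4 ≠ c0 := by
    rintro rfl
    have := hNc0 a3 ha3 ha34.symm
    grind
  have ha4b1 : a4 ≠ b1 := by
    rintro rfl
    have := hNb1 a3 ha3 ha34.symm
    grind
  have ha4b2 : a4 ≠ b2 := by
    rintro rfl
    have := hNb2 a3 ha3 ha34.symm
    grind
  have hb4c0 : b4 ≠ c0 := by
    rintro rfl
    have := hNc0 b3 hb3 hb34.symm
    grind
  have hb4a1 : b4 ≠ a1 := by
    rintro rfl
    have := hNa1 b3 hb3 hb34.symm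
    grind
  have hb4a2 : b4 ≠ a2 := by
    rintro rfl
    have := hNa2 b3 hb3 hb34.symm
    grind
  apply hplay
  clear hplay
  intro w x hx hother hxA hxD
  have hx' : x = c0 ∨ x = a4 := by
    obtain h | ⟨-, h1, h2⟩ := hx
    · exact Or.inl h
    · have := hNa3 x hxA h2
      grind
  obtain rfl | rfl := hx'
  · exact domBound_one_of_path (p := b1) (q := b2) (r := b3) (s := b4) (by grind) (by grind)
      (by grind) (by grind) hb23 hb34 hb42.symm hb31.symm hb12.ne (by grind)
  · exact domBound_one_of_path (p := c0) (q := b1) (r := b2) (s := b3) (by grind) (by grind)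
      (by grind) (by grind) hb12 hb23 hb31.symm hb2c.symm hcb1.ne (by grind)

theorem stallBound_univ (hG : G.Connected) (hn : 9 ≤ Fintype.card V) :
    StallBound G Finset.univ 1 := by
  have hni : NoIsolated G (Finset.univ : Finset V) :=
    active_empty hG (by omega) ▸ noIsolated_active
  refine stallBound_of_moves (by rw [Finset.card_univ]; omega) fun v _ => ?_
  have h2 := two_le_card_removed hni (Finset.mem_univ v)
  by_cases h3 : 3 ≤ (removed G Finset.univ v).card
  · exact (basic_bounds noIsolated_sdiff_removed).2.1.mono (by omega)
  obtain ⟨u, -, hvu⟩ := hni v (Finset.mem_univ v)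
  have hr : removed G Finset.univ v = {v, u} := by
    refine (Finset.eq_of_subset_of_card_le ?_ ?_).symm
    · intro x hx
      simp only [Finset.mem_insert, Finset.mem_singleton] at hx
      obtain rfl | rfl := hx
      · exact mem_removed_self (Finset.mem_univ _)
      · exact mem_removed_of_adj (Finset.mem_univ _) hvu
    · rw [Finset.card_pair hvu.ne]
      omega
  have hNv : ∀ y, G.Adj v y → y = u := fun y hy => by
    have h4 : y ∈ removed G Finset.univ v := mem_removed_of_adj (Finset.mem_univ _) hy
    rw [hr] at h4
    have := hy.ne'
    grind
  have hP : LeafPosition G (Finset.univ \ {v, u}) u v := by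
    refine ⟨noIsolated_sdiff_of_removed_eq hr, fun w => by grind, by simp, ?_, ?_⟩
    · intro y hy hvy
      have := hNv y hvy
      grind
    · rintro T ⟨hTA, hT⟩ ⟨x, hx⟩
      by_contra! hnot
      have huT : u ∉ T := fun h => by
        have := hTA h
        grind
      obtain ⟨p⟩ := hG.preconnected x u
      obtain ⟨d, -, hd1, hd2⟩ := p.exists_boundary_dart (T : Set V) (by simpa) (by simpa)
      have hd1' : d.fst ∈ T := by simpa using hd1
      have hd2' : d.snd ∉ T := by simpa using hd2
      have hadj := d.adj
      by_cases hu : d.snd = u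
      · exact hnot _ hd1' (hu ▸ hadj.symm)
      by_cases hv : d.snd = v
      · have := hNv _ (hv ▸ hadj.symm)
        exact huT (this ▸ hd1')
      · exact hd2' (hT _ hd1' _ (by simp [hu, hv]) hadj)
  have hcard : (Finset.univ \ {v, u} : Finset V).card = Fintype.card V - 2 := by
    rw [Finset.card_sdiff_of_subset (Finset.subset_univ _), Finset.card_pair hvu.ne,
      Finset.card_univ]
  rw [hr, Finset.card_pair hvu.ne]
  exact (hP.domBound_one (by omega)).mono (by norm_num)

end

end IsolationGame

/-- If `G` is a connected finite graph of order `n` with `ι_g'(G) = n/2`, then `n ≤ 10`. -/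
theorem stallerStart_game_isolation_half_bound_order {V : Type*} [Fintype V]
    (G : SimpleGraph V) (hG : G.Connected) (h : 2 * iotaGame' G = Fintype.card V) :
    Fintype.card V ≤ 10 := by
  classical
  by_contra! hn
  have h1 := IsolationGame.stallBound_univ hG (by omega) (Fintype.card V) ∅
    (IsolationGame.active_empty hG (by omega))
  rw [Finset.card_univ] at h1
  unfold iotaGame' at h
  omega
end
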